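/- Let H be an infinite-dimensional complex Hilbert space and γ > 0. For each m ∈ ℕ let u_m be the free pluriharmonic function with scalar coefficients (a^{(m)}, b^{(m)}) on the ball of radius γ. Suppose there is a function w : [B(H)ⁿ]_γ → B(H) such that for every r ∈ [0, γ), sup_{X ∈ [B(H)ⁿ]_r⁻} ‖u_{m,H}(X) − w(X)‖ → 0 as m → ∞. Then there exist coefficients (a, b) satisfying the radius-γ limsup conditions whose associated free pluriharmonic function u satisfies u_H(X) = w(X) for all X ∈ [B(H)ⁿ]_γ. -/

import Mathlib

open scoped ENNReal ComplexOrder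
open Filter ContinuousLinearMap

noncomputable section

abbrev Word (n : ℕ) := FreeMonoid (Fin n)

/-- The word determined by a tuple of letters. -/
def word {n k : ℕ} (f : Fin k → Fin n) : Word n :=
  FreeMonoid.ofList (List.ofFn f)

/-- The length of a word. -/
def wordLen {n : ℕ} (α : Word n) : ℕ := (FreeMonoid.toList α).length

/-- The product `X_α = X_{i₁} ⋯ X_{i_k}` for `α = g_{i₁} ⋯ g_{i_k}`. -/
def wordProd {n : ℕ} {K : Type} [NormedAddCommGroup K] [InnerProductSpace ℂ K]
    (X : Fin n → K →L[ℂ] K) (α : Word n) : K →L[ℂ] K :=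
  ((FreeMonoid.toList α).map X).prod

/-- `Σ_{|α| = k} a_α X_α`. -/
def truncSum {n : ℕ} {K : Type} [NormedAddCommGroup K] [InnerProductSpace ℂ K]
    (a : Word n → ℂ) (X : Fin n → K →L[ℂ] K) (k : ℕ) : K →L[ℂ] K :=
  ∑ f : Fin k → Fin n, a (word f) • wordProd X (word f)

/-- `Σ_{|α| = k} b_α X_α*`. -/
def truncSumAdj {n : ℕ} {K : Type} [NormedAddCommGroup K] [InnerProductSpace ℂ K]
    [CompleteSpace K] (b : Word n → ℂ) (X : Fin n → K →L[ℂ] K) (k : ℕ) : K →L[ℂ] K :=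
  ∑ f : Fin k → Fin n, b (word f) • adjoint (wordProd X (word f))

/-- The free holomorphic function `f(X) = Σ_k Σ_{|α| = k} a_α X_α`. -/
def holOp {n : ℕ} {K : Type} [NormedAddCommGroup K] [InnerProductSpace ℂ K]
    (a : Word n → ℂ) (X : Fin n → K →L[ℂ] K) : K →L[ℂ] K :=
  ∑' k : ℕ, truncSum a X k

/-- The free pluriharmonic function
`u(X) = Σ_{k ≥ 1} Σ_{|α| = k} b_α X_α* + a_{g₀} I + Σ_{k ≥ 1} Σ_{|α| = k} a_α X_α`. -/
def phOp {n : ℕ} {K : Type} [NormedAddCommGroup K] [InnerProductSpace ℂ K]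
    [CompleteSpace K] (a b : Word n → ℂ) (X : Fin n → K →L[ℂ] K) : K →L[ℂ] K :=
  (∑' k : ℕ, truncSumAdj b X (k + 1)) + a 1 • (1 : K →L[ℂ] K)
    + ∑' k : ℕ, truncSum a X (k + 1)

/-- Membership in the open noncommutative ball of radius `γ`. -/
def inBall {n : ℕ} {K : Type} [NormedAddCommGroup K] [InnerProductSpace ℂ K]
    [CompleteSpace K] (γ : ℝ) (X : Fin n → K →L[ℂ] K) : Prop :=
  ‖∑ i, X i * adjoint (X i)‖ < γ ^ 2

/-- Membership in the closed noncommutative ball of radius `γ`. -/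
def inClosedBall {n : ℕ} {K : Type} [NormedAddCommGroup K] [InnerProductSpace ℂ K]
    [CompleteSpace K] (γ : ℝ) (X : Fin n → K →L[ℂ] K) : Prop :=
  ‖∑ i, X i * adjoint (X i)‖ ≤ γ ^ 2

/-- The radius-`γ` condition `limsup_k (Σ_{|α|=k} |a_α|²)^{1/(2k)} ≤ 1/γ`. -/
def radCond {n : ℕ} (γ : ℝ) (a : Word n → ℂ) : Prop :=
  Filter.limsup
    (fun k : ℕ =>
      (∑ f : Fin k → Fin n, (‖a (word f)‖₊ : ℝ≥0∞) ^ 2) ^ ((1 : ℝ) / (2 * (k : ℝ))))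
    Filter.atTop ≤ ENNReal.ofReal (1 / γ)

/-- The coefficients of the radial function: `α ↦ r^{|α|} a_α`. -/
def scaleCoef {n : ℕ} (r : ℝ) (a : Word n → ℂ) : Word n → ℂ :=
  fun α => ((r : ℂ) ^ wordLen α) * a α

/-- Positivity of the free pluriharmonic function with coefficients `(a, b)` on the
noncommutative ball of radius `γ` of every complex Hilbert space. -/
def posPH {n : ℕ} (γ : ℝ) (a b : Word n → ℂ) : Prop :=
  ∀ (K : Type) [NormedAddCommGroup K] [InnerProductSpace ℂ K] [CompleteSpace K],
    ∀ X : Fin n → K →L[ℂ] K, inBall γ X → (phOp a b X).IsPositive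


/-- ℓ² norm of the degree `k` coefficients. -/
def SS {n : ℕ} (k : ℕ) (c : Word n → ℂ) : ℝ :=
  ‖(WithLp.toLp 2 (fun f : Fin k → Fin n => c (word f)) : EuclideanSpace ℂ (Fin k → Fin n))‖

lemma SS_nonneg {n : ℕ} (k : ℕ) (c : Word n → ℂ) : 0 ≤ SS k c := norm_nonneg _

lemma SS_sq {n : ℕ} (k : ℕ) (c : Word n → ℂ) :
    SS k c ^ 2 = ∑ f : Fin k → Fin n, ‖c (word f)‖ ^ 2 := by
  rw [SS, EuclideanSpace.norm_sq_eq]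

lemma SS_sub_le {n : ℕ} (k : ℕ) (c d : Word n → ℂ) : SS k (c - d) ≤ SS k c + SS k d :=
  norm_sub_le (WithLp.toLp 2 (fun f : Fin k → Fin n => c (word f)) :
    EuclideanSpace ℂ (Fin k → Fin n)) (WithLp.toLp 2 (fun f : Fin k → Fin n => d (word f)))

lemma norm_le_SS {n : ℕ} {k : ℕ} (c : Word n → ℂ) (f : Fin k → Fin n) :
    ‖c (word f)‖ ≤ SS k c := by
  apply le_of_sq_le_sq _ (SS_nonneg _ _)
  rw [SS_sq]
  exact Finset.single_le_sum (f := fun f : Fin k → Fin n => ‖c (word f)‖ ^ 2)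
    (fun _ _ => by positivity) (Finset.mem_univ f)

def Good {n : ℕ} (γ : ℝ) (c : Word n → ℂ) : Prop :=
  ∀ r : ℝ, 0 ≤ r → r < γ → Summable (fun k => r ^ k * SS k c)

lemma Good.sub {n : ℕ} {γ : ℝ} {c d : Word n → ℂ} (hc : Good γ c) (hd : Good γ d) :
    Good γ (c - d) := by
  intro r h0 h1
  refine Summable.of_nonneg_of_le (fun k => mul_nonneg (by positivity) (SS_nonneg _ _))
    (fun k => ?_) ((hc r h0 h1).add (hd r h0 h1))
  rw [← mul_add]
  exact mul_le_mul_of_nonneg_left (SS_sub_le _ _ _) (by positivity)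

lemma rad_sum_eq {n : ℕ} (k : ℕ) (c : Word n → ℂ) :
    (∑ f : Fin k → Fin n, (‖c (word f)‖₊ : ℝ≥0∞) ^ 2) = ENNReal.ofReal (SS k c) ^ 2 := by
  rw [← ENNReal.ofReal_pow (SS_nonneg _ _), SS_sq, ENNReal.ofReal_sum_of_nonneg]
  · refine Finset.sum_congr rfl fun f _ => ?_
    rw [ENNReal.ofReal_pow (norm_nonneg _), ofReal_norm]
    rfl
  · intros; positivity

lemma rad_term_le_iff {n : ℕ} {k : ℕ} (hk : 1 ≤ k) (c : Word n → ℂ) {t : ℝ} (ht : 0 ≤ t) :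
    (∑ f : Fin k → Fin n, (‖c (word f)‖₊ : ℝ≥0∞) ^ 2) ^ ((1 : ℝ) / (2 * (k : ℝ)))
      ≤ ENNReal.ofReal t ↔ SS k c ≤ t ^ k := by
  have hk' : (0:ℝ) < k := by exact_mod_cast hk
  rw [rad_sum_eq, one_div, ENNReal.rpow_inv_le_iff (by positivity)]
  have : ENNReal.ofReal t ^ (2 * (k:ℝ)) = (ENNReal.ofReal (t ^ k)) ^ 2 := by
    rw [ENNReal.ofReal_pow ht, ← pow_mul, ← ENNReal.rpow_natCast]
    congr 1; push_cast; ring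
  rw [this, ENNReal.pow_le_pow_left_iff (by norm_num), ENNReal.ofReal_le_ofReal_iff (by positivity)]

lemma radCond.good {n : ℕ} {γ : ℝ} {c : Word n → ℂ} (h : radCond γ c) : Good γ c := by
  intro r h0 h1
  obtain ⟨ρ, hr, hρ⟩ := exists_between h1
  have hρ0 : 0 < ρ := h0.trans_lt hr
  have hlt : ENNReal.ofReal (1 / γ) < ENNReal.ofReal (1 / ρ) := by
    rw [ENNReal.ofReal_lt_ofReal_iff (by positivity)]
    exact one_div_lt_one_div_of_lt hρ0 hρ
  have hev := Filter.eventually_lt_of_limsup_lt (lt_of_le_of_lt h hlt)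
  have hgeo : Summable (fun k : ℕ => (r / ρ) ^ k) :=
    summable_geometric_of_lt_one (by positivity) ((div_lt_one hρ0).2 hr)
  refine Summable.of_norm_bounded_eventually_nat hgeo ?_
  filter_upwards [hev, eventually_ge_atTop 1] with k hk hk1
  have := (rad_term_le_iff hk1 c (by positivity)).1 hk.le
  rw [Real.norm_of_nonneg (mul_nonneg (by positivity) (SS_nonneg _ _))]
  calc r ^ k * SS k c ≤ r ^ k * (1 / ρ) ^ k := by gcongr
    _ = (r / ρ) ^ k := by rw [← mul_pow]; congr 1; ring

lemma radCond_of_bdd {n : ℕ} {γ : ℝ} {c : Word n → ℂ} (hγ : 0 < γ)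
    (h : ∀ r, 0 < r → r < γ → ∃ C, ∀ k, 1 ≤ k → r ^ k * SS k c ≤ C) : radCond γ c := by
  have key : ∀ r, 0 < r → r < γ → Filter.limsup
    (fun k : ℕ =>
      (∑ f : Fin k → Fin n, (‖c (word f)‖₊ : ℝ≥0∞) ^ 2) ^ ((1 : ℝ) / (2 * (k : ℝ))))
    Filter.atTop ≤ ENNReal.ofReal (1 / r) := by
    intro r h0 h1
    obtain ⟨ρ, hr, hρ⟩ := exists_between h1
    have hρ0 : 0 < ρ := h0.trans hr
    obtain ⟨C, hC⟩ := h ρ hρ0 hρ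
    apply Filter.limsup_le_of_le
    · isBoundedDefault
    have ht : Tendsto (fun k : ℕ => (r / ρ) ^ k * C) atTop (nhds (0 * C)) :=
      (tendsto_pow_atTop_nhds_zero_of_lt_one (by positivity) ((div_lt_one hρ0).2 hr)).mul_const C
    rw [zero_mul] at ht
    filter_upwards [ht.eventually (gt_mem_nhds one_pos), eventually_ge_atTop 1] with k hk hk1
    rw [rad_term_le_iff hk1 c (by positivity), one_div, inv_pow]
    have hle : r ^ k * SS k c ≤ 1 := by
      calc r ^ k * SS k c = (r / ρ) ^ k * (ρ ^ k * SS k c) := by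
            rw [div_pow]; field_simp
        _ ≤ (r / ρ) ^ k * C := by gcongr; exact hC k hk1
        _ ≤ 1 := hk.le
    rw [← one_div, le_div_iff₀ (by positivity)]
    linarith
  have ht : Tendsto (fun r : ℝ => ENNReal.ofReal (1 / r)) (nhdsWithin γ (Set.Iio γ))
      (nhds (ENNReal.ofReal (1 / γ))) := by
    apply ENNReal.tendsto_ofReal
    exact (tendsto_const_nhds.div tendsto_id hγ.ne').mono_left nhdsWithin_le_nhds
  apply ge_of_tendsto ht
  filter_upwards [Ioo_mem_nhdsLT hγ] with r hr
  exact key r hr.1 hr.2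

lemma seq_limit {n : ℕ} {γ : ℝ} (hγ : 0 < γ) (k₀ : ℕ) (hk₀ : k₀ ≤ 1) (c : ℕ → Word n → ℂ)
    (hc : ∀ m, Good γ (c m))
    (h : ∀ r, 0 < r → r < γ → ∀ ε, 0 < ε → ∃ M : ℕ, ∀ m, M ≤ m → ∀ m', M ≤ m' → ∀ k, k₀ ≤ k →
      r ^ k * SS k (c m - c m') ≤ ε) :
    ∃ c' : Word n → ℂ, radCond γ c' ∧ ∀ r, 0 < r → r < γ → ∀ ε, 0 < ε → ∃ M : ℕ, ∀ m, M ≤ m →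
      ∀ k, k₀ ≤ k → r ^ k * SS k (c m - c') ≤ ε := by
  have hlim : ∀ k, k₀ ≤ k → ∀ f : Fin k → Fin n,
      ∃ z, Tendsto (fun m => c m (word f)) atTop (nhds z) := by
    intro k hk f
    apply cauchySeq_tendsto_of_complete
    rw [Metric.cauchySeq_iff]
    intro ε hε
    obtain ⟨M, hM⟩ := h (γ/2) (by positivity) (by linarith) ((γ/2)^k * (ε/2)) (by positivity)
    refine ⟨M, fun m hm m' hm' => ?_⟩
    have h1 := le_of_mul_le_mul_left (hM m hm m' hm' k hk) (by positivity)
    have h2 := norm_le_SS (c m - c m') f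
    rw [dist_eq_norm]
    simp only [Pi.sub_apply] at h2
    linarith
  let c' : Word n → ℂ := fun α => limUnder atTop (fun m => c m α)
  have hc' : ∀ k, k₀ ≤ k → ∀ f : Fin k → Fin n,
      Tendsto (fun m => c m (word f)) atTop (nhds (c' (word f))) :=
    fun k hk f => tendsto_nhds_limUnder (hlim k hk f)
  have hS : ∀ k, k₀ ≤ k → ∀ m, Tendsto (fun m' => SS k (c m - c m')) atTop
      (nhds (SS k (c m - c'))) := by
    intro k hk m
    apply Tendsto.norm
    apply ((PiLp.continuous_toLp 2 _).tendsto _).comp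
    rw [tendsto_pi_nhds]
    intro f
    exact tendsto_const_nhds.sub (hc' k hk f)
  have hconv : ∀ r, 0 < r → r < γ → ∀ ε, 0 < ε → ∃ M : ℕ, ∀ m, M ≤ m →
      ∀ k, k₀ ≤ k → r ^ k * SS k (c m - c') ≤ ε := by
    intro r h0 h1 ε hε
    obtain ⟨M, hM⟩ := h r h0 h1 ε hε
    refine ⟨M, fun m hm k hk => ?_⟩
    apply le_of_tendsto ((hS k hk m).const_mul (r ^ k))
    filter_upwards [eventually_ge_atTop M] with m' hm'
    exact hM m hm m' hm' k hk
  refine ⟨c', radCond_of_bdd hγ fun r h0 h1 => ?_, hconv⟩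
  obtain ⟨M, hM⟩ := hconv r h0 h1 1 one_pos
  refine ⟨(∑' k, r ^ k * SS k (c M)) + 1, fun k hk => ?_⟩
  have e : c' = c M - (c M - c') := by abel
  have h2 : r ^ k * SS k c' ≤ r ^ k * SS k (c M) + r ^ k * SS k (c M - c') := by
    rw [← mul_add]
    refine mul_le_mul_of_nonneg_left ?_ (by positivity)
    conv_lhs => rw [e]
    exact SS_sub_le _ _ _
  have h3 := (hc M r h0.le h1).le_tsum k (fun j _ => mul_nonneg (by positivity) (SS_nonneg _ _))
  have h4 := hM M le_rfl k (hk₀.trans hk)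
  linarith

section ops
variable {n : ℕ} {K : Type} [NormedAddCommGroup K] [InnerProductSpace ℂ K] [CompleteSpace K]

lemma word_cons {k : ℕ} (i : Fin n) (f : Fin k → Fin n) :
    word (Fin.cons i f : Fin (k+1) → Fin n) = FreeMonoid.of i * word f := by
  simp only [word, List.ofFn_cons]
  rfl

lemma wordProd_cons (X : Fin n → K →L[ℂ] K) (i : Fin n) (α : Word n) :
    wordProd X (FreeMonoid.of i * α) = X i * wordProd X α := by
  simp [wordProd]

lemma sum_norm_adj (X : Fin n → K →L[ℂ] K) {s : ℝ} (hX : inClosedBall s X) (y : K) :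
    ∑ i, ‖adjoint (X i) y‖ ^ 2 ≤ s ^ 2 * ‖y‖ ^ 2 := by
  have h : ((∑ i, ‖adjoint (X i) y‖ ^ 2 : ℝ) : ℂ)
      = inner ℂ y ((∑ i, X i * adjoint (X i)) y) := by
    rw [_root_.sum_apply, inner_sum]
    push_cast
    refine Finset.sum_congr rfl fun i _ => ?_
    change _ = inner ℂ y (X i (adjoint (X i) y))
    rw [← ContinuousLinearMap.adjoint_inner_left, inner_self_eq_norm_sq_to_K]
    rfl
  have h2 : ∑ i, ‖adjoint (X i) y‖ ^ 2 = ‖((∑ i, ‖adjoint (X i) y‖ ^ 2 : ℝ) : ℂ)‖ := by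
    rw [Complex.norm_real, Real.norm_of_nonneg (by positivity)]
  rw [h2, h]
  calc _ ≤ ‖y‖ * ‖(∑ i, X i * adjoint (X i)) y‖ := norm_inner_le_norm _ _
    _ ≤ ‖y‖ * (s ^ 2 * ‖y‖) := by
      gcongr
      exact (ContinuousLinearMap.le_opNorm _ _).trans (mul_le_mul_of_nonneg_right hX (norm_nonneg _))
    _ = _ := by ring

lemma sum_norm_adj_word (X : Fin n → K →L[ℂ] K) {s : ℝ} (hX : inClosedBall s X) (k : ℕ) :
    ∀ y : K, ∑ f : Fin k → Fin n, ‖adjoint (wordProd X (word f)) y‖ ^ 2 ≤ (s ^ k * ‖y‖) ^ 2 := by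
  induction k with
  | zero =>
    intro y
    simp only [Finset.univ_unique, Finset.sum_singleton, pow_zero, one_mul]
    have : wordProd X (word (default : Fin 0 → Fin n)) = 1 := by simp [wordProd, word]
    rw [this, ← ContinuousLinearMap.star_eq_adjoint, star_one]
    exact le_rfl
  | succ k ih =>
    intro y
    rw [← (Fin.consEquiv (fun _ : Fin (k+1) => Fin n)).sum_comp, Fintype.sum_prod_type]
    calc _ = ∑ i, ∑ f : Fin k → Fin n, ‖adjoint (wordProd X (word f)) (adjoint (X i) y)‖ ^ 2 := by
          refine Finset.sum_congr rfl fun i _ => Finset.sum_congr rfl fun f _ => ?_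
          simp only [Fin.consEquiv, Equiv.coe_fn_mk]
          rw [word_cons, wordProd_cons, ContinuousLinearMap.mul_def, ContinuousLinearMap.adjoint_comp]
          rfl
      _ ≤ ∑ i, (s ^ k * ‖adjoint (X i) y‖) ^ 2 := Finset.sum_le_sum fun i _ => ih _
      _ = (s ^ k) ^ 2 * ∑ i, ‖adjoint (X i) y‖ ^ 2 := by
          rw [Finset.mul_sum]; simp_rw [mul_pow]
      _ ≤ (s ^ k) ^ 2 * (s ^ 2 * ‖y‖ ^ 2) := by
          gcongr
          exact sum_norm_adj X hX y
      _ = _ := by ring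

lemma truncSumAdj_norm (X : Fin n → K →L[ℂ] K) {s : ℝ} (hs : 0 ≤ s) (hX : inClosedBall s X)
    (c : Word n → ℂ) (k : ℕ) : ‖truncSumAdj c X k‖ ≤ s ^ k * SS k c := by
  refine ContinuousLinearMap.opNorm_le_bound _ (mul_nonneg (by positivity) (SS_nonneg _ _)) fun y => ?_
  rw [truncSumAdj, _root_.sum_apply]
  calc _ ≤ ∑ f : Fin k → Fin n, ‖c (word f)‖ * ‖adjoint (wordProd X (word f)) y‖ := by
        refine (norm_sum_le _ _).trans (Finset.sum_le_sum fun f _ => ?_)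
        rw [_root_.smul_apply, norm_smul]
    _ ≤ √(∑ f : Fin k → Fin n, ‖c (word f)‖ ^ 2) *
        √(∑ f : Fin k → Fin n, ‖adjoint (wordProd X (word f)) y‖ ^ 2) :=
        Real.sum_mul_le_sqrt_mul_sqrt _ _ _
    _ ≤ SS k c * (s ^ k * ‖y‖) := by
        rw [← SS_sq, Real.sqrt_sq (SS_nonneg _ _)]
        gcongr
        · exact SS_nonneg _ _
        · rw [Real.sqrt_le_left (by positivity)]
          exact sum_norm_adj_word X hX k y
    _ = _ := by ring

lemma truncSum_norm (X : Fin n → K →L[ℂ] K) {s : ℝ} (hs : 0 ≤ s) (hX : inClosedBall s X)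
    (c : Word n → ℂ) (k : ℕ) : ‖truncSum c X k‖ ≤ s ^ k * SS k c := by
  have h := truncSumAdj_norm X hs hX (fun α => star (c α)) k
  have e : truncSumAdj (fun α => star (c α)) X k = adjoint (truncSum c X k) := by
    simp [truncSumAdj, truncSum, map_sum, map_smulₛₗ]
  have e2 : SS k (fun α => star (c α)) = SS k c := by
    rw [← sq_eq_sq₀ (SS_nonneg _ _) (SS_nonneg _ _), SS_sq, SS_sq]
    simp
  rw [e, e2, LinearIsometryEquiv.norm_map] at h
  exact h

lemma summable_trunc {γ s : ℝ} (hs : 0 ≤ s) (hsγ : s < γ) (X : Fin n → K →L[ℂ] K)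
    (hX : inClosedBall s X) {c : Word n → ℂ} (hc : Good γ c) : Summable (truncSum c X) :=
  Summable.of_norm_bounded (hc s hs hsγ) (truncSum_norm X hs hX c)

lemma summable_truncAdj {γ s : ℝ} (hs : 0 ≤ s) (hsγ : s < γ) (X : Fin n → K →L[ℂ] K)
    (hX : inClosedBall s X) {c : Word n → ℂ} (hc : Good γ c) :
    Summable (fun k => truncSumAdj c X (k + 1)) :=
  (summable_nat_add_iff 1).2 (Summable.of_norm_bounded (hc s hs hsγ) (truncSumAdj_norm X hs hX c))

lemma phOp_eq {γ s : ℝ} (hs : 0 ≤ s) (hsγ : s < γ) (X : Fin n → K →L[ℂ] K)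
    (hX : inClosedBall s X) {a : Word n → ℂ} (b : Word n → ℂ) (ha : Good γ a) :
    phOp a b X = (∑' k : ℕ, truncSumAdj b X (k + 1)) + ∑' k : ℕ, truncSum a X k := by
  rw [phOp, add_assoc, (summable_trunc hs hsγ X hX ha).tsum_eq_zero_add]
  congr 2
  simp [truncSum, word, wordProd]

lemma phOp_sub {γ s : ℝ} (hs : 0 ≤ s) (hsγ : s < γ) (X : Fin n → K →L[ℂ] K)
    (hX : inClosedBall s X) {a b c d : Word n → ℂ} (ha : Good γ a) (hb : Good γ b)
    (hc : Good γ c) (hd : Good γ d) :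
    phOp (a - c) (b - d) X = phOp a b X - phOp c d X := by
  rw [phOp_eq hs hsγ X hX b ha, phOp_eq hs hsγ X hX d hc, phOp_eq hs hsγ X hX _ (ha.sub hc)]
  have h1 : ∀ k, truncSum (a - c) X k = truncSum a X k - truncSum c X k := by
    intro k; simp [truncSum, sub_smul]
  have h2 : ∀ k, truncSumAdj (b - d) X k = truncSumAdj b X k - truncSumAdj d X k := by
    intro k; simp [truncSumAdj, sub_smul]
  simp_rw [h1, h2]
  rw [(summable_trunc hs hsγ X hX ha).tsum_sub (summable_trunc hs hsγ X hX hc),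
    (summable_truncAdj hs hsγ X hX hb).tsum_sub (summable_truncAdj hs hsγ X hX hd)]
  abel

lemma phOp_norm {γ s ρ ε : ℝ} (hs : 0 ≤ s) (hsρ : s < ρ) (hργ : ρ < γ) (X : Fin n → K →L[ℂ] K)
    (hX : inClosedBall s X) {a b : Word n → ℂ} (ha : Good γ a)
    (hae : ∀ k, ρ ^ k * SS k a ≤ ε) (hbe : ∀ k, 1 ≤ k → ρ ^ k * SS k b ≤ ε) :
    ‖phOp a b X‖ ≤ 2 * ((1 - s / ρ)⁻¹ * ε) := by
  have hρ : 0 < ρ := hs.trans_lt hsρ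
  rw [phOp_eq hs (hsρ.trans hργ) X hX b ha]
  have hq : s / ρ < 1 := (div_lt_one hρ).2 hsρ
  have hq0 : 0 ≤ s / ρ := by positivity
  have hg := (hasSum_geometric_of_lt_one hq0 hq).mul_right ε
  have e : ∀ k (c : Word n → ℂ), s ^ k * SS k c = (s/ρ)^k * (ρ ^ k * SS k c) := by
    intro k c; rw [div_pow]; field_simp
  have h1 : ‖∑' k : ℕ, truncSum a X k‖ ≤ (1 - s / ρ)⁻¹ * ε := by
    refine tsum_of_norm_bounded hg fun k => (truncSum_norm X hs hX a k).trans ?_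
    rw [e]
    exact mul_le_mul_of_nonneg_left (hae k) (by positivity)
  have h2 : ‖∑' k : ℕ, truncSumAdj b X (k+1)‖ ≤ (1 - s / ρ)⁻¹ * ε := by
    refine tsum_of_norm_bounded hg fun k => (truncSumAdj_norm X hs hX b (k+1)).trans ?_
    rw [e, pow_succ]
    calc _ ≤ (s/ρ)^k * 1 * ε := mul_le_mul (by gcongr) (hbe (k+1) (by omega))
          (mul_nonneg (by positivity) (SS_nonneg _ _)) (by positivity)
      _ = _ := by ring
  exact (norm_add_le _ _).trans (by linarith)

end ops

section fock
variable {n : ℕ} {H : Type} [NormedAddCommGroup H] [InnerProductSpace ℂ H] [CompleteSpace H]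

lemma word_injective (k : ℕ) : Function.Injective (word : (Fin k → Fin n) → Word n) := by
  intro f g h
  exact List.ofFn_injective h

lemma wordLen_word {k : ℕ} (f : Fin k → Fin n) : wordLen (word f) = k := by
  simp [wordLen, word]

def wordsLT (n k : ℕ) : Finset (Word n) :=
  haveI := Classical.decEq (Word n)
  (Finset.range k).biUnion fun j => (Finset.univ : Finset (Fin j → Fin n)).image word

lemma mem_wordsLT {k : ℕ} {α : Word n} (h : wordLen α < k) : α ∈ wordsLT n k := by
  classical
  simp only [wordsLT, Finset.mem_biUnion, Finset.mem_range, Finset.mem_image, Finset.mem_univ,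
    true_and]
  refine ⟨wordLen α, h, fun i => (FreeMonoid.toList α).get i, ?_⟩
  exact List.ofFn_get (FreeMonoid.toList α)

lemma exists_orthonormal_words (hH : ¬ FiniteDimensional ℂ H) :
    ∃ e : Word n → H, Orthonormal ℂ e := by
  let B := Module.Basis.ofVectorSpace ℂ H
  have hinf : Infinite (Module.Basis.ofVectorSpaceIndex ℂ H) := by
    by_contra hc
    rw [not_infinite_iff_finite] at hc
    exact hH B.finiteDimensional_of_finite
  have hli : LinearIndependent ℂ (fun k : ℕ => B (Infinite.natEmbedding _ k)) :=
    B.linearIndependent.comp _ (Infinite.natEmbedding _).injective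
  have ho := InnerProductSpace.gramSchmidtNormed_orthonormal hli
  haveI : Countable (Word n) := inferInstanceAs (Countable (List (Fin n)))
  obtain ⟨g, hg⟩ := exists_injective_nat (Word n)
  exact ⟨_, ho.comp g hg⟩

lemma ortho_proj_norm {ι : Type} {v : ι → H} (hv : Orthonormal ℂ v) (G : Finset ι) (y : H) :
    ‖∑ p ∈ G, inner ℂ (v p) y • v p‖ ≤ ‖y‖ := by
  refine le_of_sq_le_sq ?_ (norm_nonneg _)
  refine le_trans (le_of_eq ?_) (hv.sum_inner_products_le y (s := G))
  have h := hv.inner_sum (fun p => inner ℂ (v p) y) (fun p => inner ℂ (v p) y) G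
  rw [inner_self_eq_norm_sq_to_K] at h
  have h2 : ((‖∑ p ∈ G, inner ℂ (v p) y • v p‖ ^ 2 : ℝ) : ℂ)
      = ((∑ p ∈ G, ‖inner ℂ (v p) y‖ ^ 2 : ℝ) : ℂ) := by
    push_cast
    refine h.trans (Finset.sum_congr rfl fun p _ => ?_)
    rw [Complex.conj_mul']
  exact_mod_cast h2

def shiftOp (e : Word n → H) (F : Finset (Word n)) (r : ℝ) (i : Fin n) : H →L[ℂ] H :=
  ∑ α ∈ F, (r : ℂ) • InnerProductSpace.rankOne ℂ (e (FreeMonoid.of i * α)) (e α)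

lemma shiftOp_apply (e : Word n → H) (F : Finset (Word n)) (r : ℝ) (i : Fin n) (y : H) :
    shiftOp e F r i y = ∑ α ∈ F, (r : ℂ) • inner ℂ (e α) y • e (FreeMonoid.of i * α) := by
  simp [shiftOp, _root_.sum_apply]

lemma adj_shiftOp_apply (e : Word n → H) (F : Finset (Word n)) (r : ℝ) (i : Fin n) (y : H) :
    adjoint (shiftOp e F r i) y
      = ∑ α ∈ F, (r : ℂ) • inner ℂ (e (FreeMonoid.of i * α)) y • e α := by
  rw [shiftOp, map_sum, _root_.sum_apply]
  refine Finset.sum_congr rfl fun α _ => ?_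
  rw [map_smulₛₗ, InnerProductSpace.adjoint_rankOne, _root_.smul_apply, Complex.conj_ofReal,
    InnerProductSpace.rankOne_apply]

lemma shiftOp_basis {e : Word n → H} (he : Orthonormal ℂ e) (F : Finset (Word n)) (r : ℝ)
    (i : Fin n) (β : Word n) : ∃ c : ℂ, shiftOp e F r i (e β) = c • e (FreeMonoid.of i * β) ∧
      (β ∈ F → c = r) := by
  classical
  refine ⟨if β ∈ F then r else 0, ?_, fun h => by simp [h]⟩
  rw [shiftOp_apply]
  simp_rw [orthonormal_iff_ite.1 he]
  simp

lemma of_mul_ne_one (i : Fin n) (α : Word n) : FreeMonoid.of i * α ≠ 1 := by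
  intro h
  exact List.cons_ne_nil i (FreeMonoid.toList α) h

lemma adj_shiftOp_one {e : Word n → H} (he : Orthonormal ℂ e) (F : Finset (Word n)) (r : ℝ)
    (i : Fin n) : adjoint (shiftOp e F r i) (e 1) = 0 := by
  rw [adj_shiftOp_apply]
  refine Finset.sum_eq_zero fun α _ => ?_
  rw [he.2 (of_mul_ne_one i α)]
  simp

lemma shiftOp_ball {e : Word n → H} (he : Orthonormal ℂ e) (F : Finset (Word n)) (r : ℝ) :
    inClosedBall r (shiftOp e F r) := by
  classical
  refine ContinuousLinearMap.opNorm_le_bound _ (by positivity) fun y => ?_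
  let v : Fin n × Word n → H := fun p => e (FreeMonoid.of p.1 * p.2)
  have hv : Orthonormal ℂ v := by
    refine he.comp (fun p : Fin n × Word n => FreeMonoid.of p.1 * p.2) ?_
    rintro ⟨i, α⟩ ⟨j, β⟩ h
    have := List.cons.inj (show i :: FreeMonoid.toList α = j :: FreeMonoid.toList β from h)
    exact Prod.ext this.1 this.2
  have key : (∑ i, shiftOp e F r i * adjoint (shiftOp e F r i)) y
      = ((r:ℂ) ^ 2) • ∑ p ∈ (Finset.univ : Finset (Fin n)) ×ˢ F, inner ℂ (v p) y • v p := by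
    rw [_root_.sum_apply, Finset.sum_product, Finset.smul_sum]
    refine Finset.sum_congr rfl fun i _ => ?_
    change shiftOp e F r i (adjoint (shiftOp e F r i) y) = _
    rw [adj_shiftOp_apply, map_sum, Finset.smul_sum]
    refine Finset.sum_congr rfl fun α hα => ?_
    obtain ⟨c, hc, hc'⟩ := shiftOp_basis he F r i α
    rw [map_smul, map_smul, hc, hc' hα]
    simp only [smul_smul, v]
    congr 1; ring
  rw [key, norm_smul]
  simp only [norm_pow, Complex.norm_real, Real.norm_eq_abs, sq_abs]
  gcongr
  exact ortho_proj_norm hv _ y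

lemma wordProd_shift {e : Word n → H} (he : Orthonormal ℂ e) (k : ℕ) (r : ℝ) (α : Word n) :
    ∃ c : ℂ, wordProd (shiftOp e (wordsLT n k) r) α (e 1) = c • e α ∧
      (wordLen α ≤ k → c = (r : ℂ) ^ wordLen α) := by
  induction α using FreeMonoid.inductionOn' with
  | one => exact ⟨1, by simp [wordProd], by simp [wordLen]⟩
  | of_mul i α ih =>
    obtain ⟨c, hc, hc'⟩ := ih
    obtain ⟨d, hd, hd'⟩ := shiftOp_basis he (wordsLT n k) r i α
    have hl : wordLen (FreeMonoid.of i * α) = wordLen α + 1 := by simp [wordLen]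
    refine ⟨c * d, ?_, fun h => ?_⟩
    · rw [wordProd_cons]
      change shiftOp e (wordsLT n k) r i (wordProd _ α (e 1)) = _
      rw [hc, map_smul, hd, smul_smul]
    · rw [hl] at h ⊢
      rw [hc' (by omega), hd' (mem_wordsLT (by omega)), pow_succ]

lemma adj_wordProd_shift {e : Word n → H} (he : Orthonormal ℂ e) (F : Finset (Word n)) (r : ℝ)
    {j : ℕ} (f : Fin (j+1) → Fin n) :
    adjoint (wordProd (shiftOp e F r) (word f)) (e 1) = 0 := by
  obtain ⟨i, g, rfl⟩ : ∃ i g, f = Fin.cons i g := ⟨f 0, Fin.tail f, (Fin.cons_self_tail f).symm⟩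
  rw [word_cons, wordProd_cons, ContinuousLinearMap.mul_def, ContinuousLinearMap.adjoint_comp,
    ContinuousLinearMap.comp_apply, adj_shiftOp_one he, map_zero]

lemma inner_word {e : Word n → H} (he : Orthonormal ℂ e) (k : ℕ) (r : ℝ) (f₀ : Fin k → Fin n)
    (α : Word n) [Decidable (α = word f₀)] :
    inner ℂ (e (word f₀)) (wordProd (shiftOp e (wordsLT n k) r) α (e 1))
      = if α = word f₀ then (r : ℂ) ^ k else 0 := by
  obtain ⟨c, hc, hc'⟩ := wordProd_shift he k r α
  rw [hc, inner_smul_right]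
  split_ifs with h
  · subst h
    rw [hc' (wordLen_word f₀).le, wordLen_word, inner_self_eq_norm_sq_to_K, he.1]
    simp
  · rw [he.2 (Ne.symm h), mul_zero]

lemma sum_ite_word (c : Word n → ℂ) (r : ℂ) {k : ℕ} (f₀ : Fin k → Fin n) (j : ℕ)
    [DecidableEq (Word n)] :
    ∑ f : Fin j → Fin n, c (word f) * (if word f = word f₀ then r ^ k else 0)
      = if j = k then c (word f₀) * r ^ k else 0 := by
  split_ifs with h
  · subst h
    rw [Finset.sum_eq_single f₀]
    · simp
    · intro f _ hf
      rw [if_neg (fun h => hf (word_injective _ h)), mul_zero]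
    · simp
  · refine Finset.sum_eq_zero fun f _ => ?_
    rw [if_neg, mul_zero]
    intro hf
    have := congrArg wordLen hf
    rw [wordLen_word, wordLen_word] at this
    exact h this

lemma coef_a {γ r : ℝ} (hr : 0 ≤ r) (hrγ : r < γ) {e : Word n → H} (he : Orthonormal ℂ e)
    {a b : Word n → ℂ} (ha : Good γ a) (hb : Good γ b) {k : ℕ} (f₀ : Fin k → Fin n) :
    inner ℂ (e (word f₀)) (phOp a b (shiftOp e (wordsLT n k) r) (e 1))
      = a (word f₀) * (r : ℂ) ^ k := by
  classical
  set X := shiftOp e (wordsLT n k) r with hXdef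
  have hX : inClosedBall r X := shiftOp_ball he _ r
  let φ : (H →L[ℂ] H) →L[ℂ] ℂ :=
    (innerSL ℂ (e (word f₀))) ∘L (ContinuousLinearMap.apply ℂ H (e 1))
  have hφ : ∀ T, φ T = inner ℂ (e (word f₀)) (T (e 1)) := fun T => rfl
  rw [← hφ, phOp_eq hr hrγ X hX b ha, map_add, φ.map_tsum (summable_truncAdj hr hrγ X hX hb),
    φ.map_tsum (summable_trunc hr hrγ X hX ha)]
  have h1 : ∀ j, φ (truncSumAdj b X (j+1)) = 0 := by
    intro j
    rw [truncSumAdj, map_sum]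
    refine Finset.sum_eq_zero fun f _ => ?_
    rw [map_smul, hφ, hXdef, adj_wordProd_shift he]
    simp
  have h2 : ∀ j, φ (truncSum a X j) = if j = k then a (word f₀) * (r:ℂ) ^ k else 0 := by
    intro j
    rw [truncSum, map_sum, ← sum_ite_word]
    refine Finset.sum_congr rfl fun f _ => ?_
    rw [map_smul, hφ, hXdef, inner_word he, smul_eq_mul]
  simp_rw [h1, h2]
  simp

lemma coef_b {γ r : ℝ} (hr : 0 ≤ r) (hrγ : r < γ) {e : Word n → H} (he : Orthonormal ℂ e)
    {a b : Word n → ℂ} (ha : Good γ a) (hb : Good γ b) {k : ℕ} (f₀ : Fin (k+1) → Fin n) :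
    inner ℂ (e 1) (phOp a b (shiftOp e (wordsLT n (k+1)) r) (e (word f₀)))
      = b (word f₀) * (r : ℂ) ^ (k+1) := by
  classical
  set X := shiftOp e (wordsLT n (k+1)) r with hXdef
  have hX : inClosedBall r X := shiftOp_ball he _ r
  let φ : (H →L[ℂ] H) →L[ℂ] ℂ :=
    (innerSL ℂ (e 1)) ∘L (ContinuousLinearMap.apply ℂ H (e (word f₀)))
  have hφ : ∀ T, φ T = inner ℂ (e 1) (T (e (word f₀))) := fun T => rfl
  rw [← hφ, phOp, map_add, map_add, φ.map_tsum (summable_truncAdj hr hrγ X hX hb),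
    φ.map_tsum ((summable_nat_add_iff 1).2 (summable_trunc hr hrγ X hX ha))]
  have h1 : ∀ j, φ (truncSum a X (j+1)) = 0 := by
    intro j
    rw [truncSum, map_sum]
    refine Finset.sum_eq_zero fun f _ => ?_
    rw [map_smul, hφ, ← ContinuousLinearMap.adjoint_inner_left, hXdef, adj_wordProd_shift he]
    simp
  have h2 : ∀ j, φ (truncSumAdj b X (j+1)) = if j = k then b (word f₀) * (r:ℂ) ^ (k+1) else 0 := by
    intro j
    have := sum_ite_word b r f₀ (j+1)
    simp only [Nat.add_right_cancel_iff] at this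
    rw [truncSumAdj, map_sum, ← this]
    refine Finset.sum_congr rfl fun f _ => ?_
    rw [map_smul, hφ, ContinuousLinearMap.adjoint_inner_right, ← inner_conj_symm, hXdef,
      inner_word he, smul_eq_mul]
    split_ifs <;> simp
  have h3 : φ (a 1 • (1 : H →L[ℂ] H)) = 0 := by
    rw [map_smul, hφ]
    have : (1 : Word n) ≠ word f₀ := by
      intro h
      have := congrArg wordLen h
      rw [wordLen_word] at this
      simp [wordLen] at this
    change a 1 • inner ℂ (e 1) (e (word f₀)) = 0
    rw [he.2 this, smul_zero]
  simp_rw [h1, h2, h3]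
  simp

lemma SS_bound {c : Word n → ℂ} {r C : ℝ} (hr : 0 ≤ r) (hC : 0 ≤ C) {k : ℕ} {v : H}
    (hv : ‖v‖ ≤ C) {e : Word n → H} (he : Orthonormal ℂ e)
    (h : ∀ f : Fin k → Fin n, ‖inner ℂ (e (word f)) v‖ = ‖c (word f) * (r : ℂ) ^ k‖) :
    r ^ k * SS k c ≤ C := by
  refine le_of_sq_le_sq ?_ hC
  have hB := (he.comp word (word_injective k)).sum_inner_products_le v (s := Finset.univ)
  calc (r ^ k * SS k c) ^ 2 = ∑ f : Fin k → Fin n, ‖inner ℂ (e (word f)) v‖ ^ 2 := by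
        rw [mul_pow, SS_sq, Finset.mul_sum]
        refine Finset.sum_congr rfl fun f _ => ?_
        rw [h, norm_mul, norm_pow, Complex.norm_real, Real.norm_of_nonneg hr]
        ring
    _ ≤ ‖v‖ ^ 2 := hB
    _ ≤ C ^ 2 := by gcongr

lemma coef_bound {γ r C : ℝ} (hr : 0 ≤ r) (hrγ : r < γ) (hH : ¬ FiniteDimensional ℂ H)
    {a b : Word n → ℂ} (ha : Good γ a) (hb : Good γ b)
    (h : ∀ X : Fin n → H →L[ℂ] H, inClosedBall r X → ‖phOp a b X‖ ≤ C) :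
    (∀ k, r ^ k * SS k a ≤ C) ∧ (∀ k, 1 ≤ k → r ^ k * SS k b ≤ C) := by
  obtain ⟨e, he⟩ := exists_orthonormal_words (n := n) hH
  have hX := fun k => h _ (shiftOp_ball he (wordsLT n k) r)
  have hC : 0 ≤ C := (norm_nonneg _).trans (hX 0)
  constructor
  · intro k
    refine SS_bound hr hC (v := phOp a b (shiftOp e (wordsLT n k) r) (e 1)) ?_ he
      fun f => by rw [coef_a hr hrγ he ha hb]
    refine (ContinuousLinearMap.le_opNorm _ _).trans ?_
    rw [he.1, mul_one]
    exact hX k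
  · intro k hk
    obtain ⟨k, rfl⟩ : ∃ j, k = j + 1 := ⟨k - 1, by omega⟩
    refine SS_bound hr hC (v := adjoint (phOp a b (shiftOp e (wordsLT n (k+1)) r)) (e 1)) ?_ he
      fun f => by
        rw [ContinuousLinearMap.adjoint_inner_right, ← inner_conj_symm, coef_b hr hrγ he ha hb,
          RCLike.norm_conj]
    refine (ContinuousLinearMap.le_opNorm _ _).trans ?_
    rw [he.1, mul_one, LinearIsometryEquiv.norm_map]
    exact hX (k+1)

end fock

/-- Weierstrass-type convergence theorem: a sequence of free pluriharmonic
functions converging uniformly on every closed ball of radius `r < γ` of an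
infinite-dimensional Hilbert space `H` converges to a free pluriharmonic function. -/
theorem stmt_7 (n : ℕ) (hn : 1 ≤ n) (γ : ℝ) (hγ : 0 < γ)
    (H : Type) [NormedAddCommGroup H] [InnerProductSpace ℂ H] [CompleteSpace H]
    (hH : ¬ FiniteDimensional ℂ H)
    (a b : ℕ → Word n → ℂ)
    (ha : ∀ m : ℕ, radCond γ (a m)) (hb : ∀ m : ℕ, radCond γ (b m))
    (w : (Fin n → H →L[ℂ] H) → H →L[ℂ] H)
    (hconv : ∀ r : ℝ, 0 ≤ r → r < γ → ∀ ε : ℝ, 0 < ε →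
      ∃ M : ℕ, ∀ m : ℕ, M ≤ m → ∀ X : Fin n → H →L[ℂ] H, inClosedBall r X →
        ‖phOp (a m) (b m) X - w X‖ < ε) :
    ∃ a' b' : Word n → ℂ, radCond γ a' ∧ radCond γ b' ∧
      ∀ X : Fin n → H →L[ℂ] H, inBall γ X → phOp a' b' X = w X := by
  have hga := fun m => (ha m).good
  have hgb := fun m => (hb m).good
  have hcau : ∀ r, 0 < r → r < γ → ∀ ε, 0 < ε → ∃ M : ℕ, ∀ m, M ≤ m → ∀ m', M ≤ m' →
      (∀ k, r ^ k * SS k (a m - a m') ≤ ε) ∧ (∀ k, 1 ≤ k → r ^ k * SS k (b m - b m') ≤ ε) := by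
    intro r h0 h1 ε hε
    obtain ⟨M, hM⟩ := hconv r h0.le h1 (ε / 2) (by positivity)
    refine ⟨M, fun m hm m' hm' => ?_⟩
    refine coef_bound h0.le h1 hH ((hga m).sub (hga m')) ((hgb m).sub (hgb m')) fun X hX => ?_
    rw [phOp_sub h0.le h1 X hX (hga m) (hgb m) (hga m') (hgb m')]
    have e1 := hM m hm X hX
    have e2 := hM m' hm' X hX
    have e3 := norm_sub_le (phOp (a m) (b m) X - w X) (phOp (a m') (b m') X - w X)
    rw [sub_sub_sub_cancel_right] at e3
    linarith
  obtain ⟨a', ha', hca⟩ := seq_limit hγ 0 (by norm_num) a hga (fun r h0 h1 ε hε => by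
    obtain ⟨M, hM⟩ := hcau r h0 h1 ε hε
    exact ⟨M, fun m hm m' hm' k _ => (hM m hm m' hm').1 k⟩)
  obtain ⟨b', hb', hcb⟩ := seq_limit hγ 1 le_rfl b hgb (fun r h0 h1 ε hε => by
    obtain ⟨M, hM⟩ := hcau r h0 h1 ε hε
    exact ⟨M, fun m hm m' hm' k hk => (hM m hm m' hm').2 k hk⟩)
  refine ⟨a', b', ha', hb', fun X hX => ?_⟩
  set s : ℝ := √‖∑ i, X i * adjoint (X i)‖ with hsdef
  have hs : 0 ≤ s := Real.sqrt_nonneg _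
  have hsγ : s < γ := by
    rw [hsdef, Real.sqrt_lt' hγ]
    exact hX
  have hXs : inClosedBall s X := by
    rw [inClosedBall, hsdef, Real.sq_sqrt (norm_nonneg _)]
  obtain ⟨ρ, hsρ, hργ⟩ := exists_between hsγ
  have hρ : 0 < ρ := hs.trans_lt hsρ
  have hq : 0 < 1 - s / ρ := sub_pos.2 ((div_lt_one hρ).2 hsρ)
  rw [← sub_eq_zero, ← norm_le_zero_iff]
  refine le_of_forall_pos_le_add fun ε hε => ?_
  obtain ⟨M₁, h1⟩ := hconv s hs hsγ (ε / 2) (by positivity)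
  obtain ⟨M₂, h2⟩ := hca ρ hρ hργ ((1 - s / ρ) * (ε / 4)) (by positivity)
  obtain ⟨M₃, h3⟩ := hcb ρ hρ hργ ((1 - s / ρ) * (ε / 4)) (by positivity)
  let m := max M₁ (max M₂ M₃)
  have e1 := h1 m (le_max_left _ _) X hXs
  have e2 := phOp_norm hs hsρ hργ X hXs ((hga m).sub ha'.good)
    (fun k => h2 m ((le_max_left _ _).trans (le_max_right _ _)) k (Nat.zero_le _))
    (fun k hk => h3 m ((le_max_right _ _).trans (le_max_right _ _)) k hk)
  rw [phOp_sub hs hsγ X hXs (hga m) (hgb m) ha'.good hb'.good, inv_mul_cancel_left₀ hq.ne'] at e2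
  have e3 := norm_sub_le (phOp (a m) (b m) X - w X) (phOp (a m) (b m) X - phOp a' b' X)
  rw [sub_sub_sub_cancel_left] at e3
  linarith

end
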